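/- arXiv:2511.06062 — 5 statements merged into one kernel-verified Lean document; each statement's English description precedes it below -/
import Mathlib

section
/- An observation mask Ω ⊆ ⟦N⟧ satisfies unique recovery if and only if the matrix V_Ω over 𝔽₂, whose rows are the vectors v_α for α ∈ Ω, has rank n − d + 1 over 𝔽₂. -/
namespace RankOneTC

open scoped BigOperators
open MeasureTheory

/-- The index set `⟦N⟧ = [n 0] × ⋯ × [n (d-1)]`. -/
abbrev Idx {d : ℕ} (n : Fin d → ℕ) : Type := ∀ i : Fin d, Fin (n i)

/-- A tensor is rank one if it is an outer product of `d` vectors. -/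
def IsRankOne {d : ℕ} {n : Fin d → ℕ} (T : Idx n → ℝ) : Prop :=
  ∃ u : ∀ i : Fin d, Fin (n i) → ℝ, ∀ α : Idx n, T α = ∏ i : Fin d, u i (α i)

/-- `Ω` satisfies unique recovery: for any nonzero observed values, the rank-one
completion problem is infeasible or has exactly one solution. -/
def UniqueRecovery {d : ℕ} {n : Fin d → ℕ} (Ω : Set (Idx n)) : Prop :=
  ∀ That : Idx n → ℝ, (∀ α ∈ Ω, That α ≠ 0) →
    {T : Idx n → ℝ | IsRankOne T ∧ ∀ α ∈ Ω, T α = That α}.Subsingleton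

/-- The 𝔽₂ vector `v_α`, the concatenation of indicator vectors of the coordinates. -/
def vF2 {d : ℕ} {n : Fin d → ℕ} (α : Idx n) : (Σ i : Fin d, Fin (n i)) → ZMod 2 :=
  fun s => if α s.1 = s.2 then 1 else 0

/-- A generalized square: four distinct tuples whose `v`-vectors sum to zero over 𝔽₂. -/
def IsGenSquare {d : ℕ} {n : Fin d → ℕ} (α₁ α₂ α₃ α₄ : Idx n) : Prop :=
  [α₁, α₂, α₃, α₄].Nodup ∧ vF2 α₁ + vF2 α₂ + vF2 α₃ + vF2 α₄ = 0

/-- A square `{α₁,α₂;α₃,α₄}`: four distinct tuples with coordinatewise equal max and min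
of the two opposite pairs. -/
def IsSquare {d : ℕ} {n : Fin d → ℕ} (α₁ α₂ α₃ α₄ : Idx n) : Prop :=
  [α₁, α₂, α₃, α₄].Nodup ∧
    ∀ k : Fin d, max (α₁ k) (α₂ k) = max (α₃ k) (α₄ k) ∧
      min (α₁ k) (α₂ k) = min (α₃ k) (α₄ k)

/-- The GS-propagated set `𝒫_GS(Ω)` as an inductive predicate. -/
inductive PGS {d : ℕ} {n : Fin d → ℕ} (Ω : Set (Idx n)) : Idx n → Prop
  | base {α : Idx n} : α ∈ Ω → PGS Ω α
  | prop {α₁ α₂ α₃ β : Idx n} : IsGenSquare α₁ α₂ α₃ β →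
      PGS Ω α₁ → PGS Ω α₂ → PGS Ω α₃ → PGS Ω β

def GSPropagation {d : ℕ} {n : Fin d → ℕ} (Ω : Set (Idx n)) : Prop :=
  ∀ β : Idx n, PGS Ω β

/-- The S-propagated set `𝒫_S(Ω)` as an inductive predicate. -/
inductive PS {d : ℕ} {n : Fin d → ℕ} (Ω : Set (Idx n)) : Idx n → Prop
  | base {α : Idx n} : α ∈ Ω → PS Ω α
  | prop {α₁ α₂ α₃ β : Idx n} : IsSquare α₁ α₂ α₃ β →
      PS Ω α₁ → PS Ω α₂ → PS Ω α₃ → PS Ω β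

def SPropagation {d : ℕ} {n : Fin d → ℕ} (Ω : Set (Idx n)) : Prop :=
  ∀ β : Idx n, PS Ω β

/-- The SR-propagated set `𝒫_SR(Ω)` as an inductive predicate. -/
inductive PSR {d : ℕ} {n : Fin d → ℕ} (Ω : Set (Idx n)) : Idx n → Prop
  | base {α : Idx n} : α ∈ Ω → PSR Ω α
  | prop {α₁ β α₂ γ : Idx n} : IsSquare α₁ β α₂ γ →
      α₁ ∈ Ω → α₂ ∈ Ω → PSR Ω β → PSR Ω γ

def SRPropagation {d : ℕ} {n : Fin d → ℕ} (Ω : Set (Idx n)) : Prop :=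
  ∀ β : Idx n, PSR Ω β

/-- A sequence is strongly connected if each later element agrees with some earlier
element in exactly `d - 1` coordinates. -/
def StronglyConnected {d : ℕ} {n : Fin d → ℕ} {p : ℕ} (α : Fin p → Idx n) : Prop :=
  ∀ k : Fin p, 0 < (k : ℕ) → ∃ i : Fin p, i < k ∧
    (Finset.univ.filter fun j : Fin d => α k j = α i j).card = d - 1

/-- A-propagation: a strongly connected sequence of elements of `Ω` covering all
coordinates. -/
def APropagation {d : ℕ} {n : Fin d → ℕ} (Ω : Set (Idx n)) : Prop :=
  ∃ (p : ℕ) (α : Fin p → Idx n), (∀ k, α k ∈ Ω) ∧ StronglyConnected α ∧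
    ∀ (i : Fin d) (j : Fin (n i)), ∃ k : Fin p, α k i = j

/-- The 𝔽₂ matrix `V_Ω` whose rows are the vectors `v_α`, `α ∈ Ω`. -/
def maskMatrix {d : ℕ} {n : Fin d → ℕ} (Ω : Finset (Idx n)) :
    Matrix {α : Idx n // α ∈ Ω} (Σ i : Fin d, Fin (n i)) (ZMod 2) :=
  Matrix.of fun α s => vF2 α.1 s

/-! ### SDP formulations -/

/-- The bordered matrix `𝐗 = [[1, xᵀ],[x, X]]`, indexed by `Option (Idx n)` where
`none` is the extra index. -/
def border {d : ℕ} {n : Fin d → ℕ} (x : Idx n → ℝ) (X : Matrix (Idx n) (Idx n) ℝ) :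
    Matrix (Option (Idx n)) (Option (Idx n)) ℝ :=
  Matrix.of fun a b =>
    match a, b with
    | Option.none, Option.none => (1 : ℝ)
    | Option.none, Option.some β => x β
    | Option.some α, Option.none => x α
    | Option.some α, Option.some β => X α β

/-- Feasibility for the exact SDP relaxation (SDP-E). -/
structure SDPEFeasible {d : ℕ} {n : Fin d → ℕ} (Ω : Set (Idx n)) (That : Idx n → ℝ)
    (x : Idx n → ℝ) (X : Matrix (Idx n) (Idx n) ℝ) : Prop where
  isSymm : X.IsSymm
  obs : ∀ α ∈ Ω, x α = That α
  obsDiag : ∀ α ∈ Ω, X α α = That α ^ 2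
  squares : ∀ α₁ α₂ α₃ α₄ : Idx n, IsSquare α₁ α₂ α₃ α₄ → X α₁ α₂ = X α₃ α₄
  psd : (border x X).PosSemidef

/-- Tightness of (SDP-E): the matrix `𝐗̄` built from the completion `T` is feasible and
is the unique minimizer of the trace objective. -/
def SDPETight {d : ℕ} {n : Fin d → ℕ} (Ω : Set (Idx n)) (That T : Idx n → ℝ) : Prop :=
  SDPEFeasible Ω That T (Matrix.vecMulVec T T) ∧
  ∀ x X, SDPEFeasible Ω That x X →
    Matrix.trace (Matrix.vecMulVec T T) ≤ Matrix.trace X ∧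
    (Matrix.trace X = Matrix.trace (Matrix.vecMulVec T T) →
      x = T ∧ X = Matrix.vecMulVec T T)

/-- Tightness of the weighted relaxation (SDP-Eʷ) with weights `w`. -/
def SDPEwTight {d : ℕ} {n : Fin d → ℕ} (Ω : Set (Idx n)) (w : Idx n → ℝ)
    (That T : Idx n → ℝ) : Prop :=
  SDPEFeasible Ω That T (Matrix.vecMulVec T T) ∧
  ∀ x X, SDPEFeasible Ω That x X →
    (∑ β : Idx n, w β * Matrix.vecMulVec T T β β) ≤ (∑ β : Idx n, w β * X β β) ∧
    ((∑ β : Idx n, w β * X β β) = (∑ β : Idx n, w β * Matrix.vecMulVec T T β β) →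
      x = T ∧ X = Matrix.vecMulVec T T)

/-- Feasibility for the noisy SDP relaxation (SDP-N). -/
structure SDPNFeasible {d : ℕ} {n : Fin d → ℕ}
    (x : Idx n → ℝ) (X : Matrix (Idx n) (Idx n) ℝ) : Prop where
  isSymm : X.IsSymm
  squares : ∀ α₁ α₂ α₃ α₄ : Idx n, IsSquare α₁ α₂ α₃ α₄ → X α₁ α₂ = X α₃ α₄
  psd : (border x X).PosSemidef

/-- Objective of (SDP-N) with noisy data `Teps` and penalty constant `c`. -/
noncomputable def sdpnObj {d : ℕ} {n : Fin d → ℕ} (Ω : Finset (Idx n))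
    (Teps : Idx n → ℝ) (c : ℝ) (x : Idx n → ℝ) (X : Matrix (Idx n) (Idx n) ℝ) : ℝ :=
  Matrix.trace X + c * ∑ α ∈ Ω, (X α α - 2 * Teps α * x α + Teps α ^ 2)

/-- Optimality for (SDP-N). -/
def SDPNOptimal {d : ℕ} {n : Fin d → ℕ} (Ω : Finset (Idx n)) (Teps : Idx n → ℝ)
    (c : ℝ) (x : Idx n → ℝ) (X : Matrix (Idx n) (Idx n) ℝ) : Prop :=
  SDPNFeasible x X ∧
    ∀ y Y, SDPNFeasible y Y → sdpnObj Ω Teps c x X ≤ sdpnObj Ω Teps c y Y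

/-- Frobenius norm of a square real matrix. -/
noncomputable def frob {m : Type*} [Fintype m] (A : Matrix m m ℝ) : ℝ :=
  Real.sqrt (∑ a : m, ∑ b : m, A a b ^ 2)

/-- `‖ε‖_∞ = max_{α ∈ Ω} |ε α|`. -/
noncomputable def supNormOn {d : ℕ} {n : Fin d → ℕ} (Ω : Finset (Idx n))
    (ε : Idx n → ℝ) : ℝ :=
  ⨆ α : {a : Idx n // a ∈ Ω}, |ε (α : Idx n)|

/-- The function `χ(s) = s + √s`. -/
noncomputable def chiFn (s : ℝ) : ℝ := s + Real.sqrt s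

/-! ### Polynomial (sum of squares) machinery -/

/-- `f_α = x_α - T̂_α`. -/
noncomputable def fPoly {d : ℕ} {n : Fin d → ℕ} (That : Idx n → ℝ) (α : Idx n) :
    MvPolynomial (Idx n) ℝ :=
  MvPolynomial.X α - MvPolynomial.C (That α)

/-- `g_α = x_α² - T̂_α²`. -/
noncomputable def gPoly {d : ℕ} {n : Fin d → ℕ} (That : Idx n → ℝ) (α : Idx n) :
    MvPolynomial (Idx n) ℝ :=
  MvPolynomial.X α ^ 2 - MvPolynomial.C (That α ^ 2)

/-- Sums of squares of polynomials. -/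
def IsSOS {d : ℕ} {n : Fin d → ℕ} (p : MvPolynomial (Idx n) ℝ) : Prop :=
  ∃ (k : ℕ) (q : Fin k → MvPolynomial (Idx n) ℝ), p = ∑ i : Fin k, q i ^ 2

/-- `Σ_{N,2}`: sums of squares of degree at most 2. -/
def SigmaN2 {d : ℕ} {n : Fin d → ℕ} (p : MvPolynomial (Idx n) ℝ) : Prop :=
  IsSOS p ∧ p.totalDegree ≤ 2

/-- The truncated ideal `I₂`, the span of the `f_α` and `g_α` for `α ∈ Ω`. -/
noncomputable def I2span {d : ℕ} {n : Fin d → ℕ} (Ω : Set (Idx n)) (That : Idx n → ℝ) :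
    Submodule ℝ (MvPolynomial (Idx n) ℝ) :=
  Submodule.span ℝ
    ({p | ∃ α ∈ Ω, p = fPoly That α} ∪ {p | ∃ α ∈ Ω, p = gPoly That α})

/-- The truncated ideal `J₂`, the span of the square relations. -/
noncomputable def J2span {d : ℕ} (n : Fin d → ℕ) : Submodule ℝ (MvPolynomial (Idx n) ℝ) :=
  Submodule.span ℝ
    {p | ∃ a b c e : Idx n, IsSquare a b c e ∧
      p = MvPolynomial.X a * MvPolynomial.X b - MvPolynomial.X c * MvPolynomial.X e}

/-- The quadratic polynomial `[1;x]ᵀ Q [1;x]` associated to a matrix `Q ∈ 𝕊^{N+1}`. -/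
noncomputable def gramPoly {d : ℕ} {n : Fin d → ℕ}
    (Q : Matrix (Option (Idx n)) (Option (Idx n)) ℝ) : MvPolynomial (Idx n) ℝ :=
  ∑ a : Option (Idx n), ∑ b : Option (Idx n),
    MvPolynomial.C (Q a b) * (Option.elim a 1 MvPolynomial.X) *
      (Option.elim b 1 MvPolynomial.X)

/-! ### Dual of the noisy SDP -/

/-- The trace inner product `A • B` of two matrices. -/
noncomputable def dotM {m : Type*} [Fintype m] (A B : Matrix m m ℝ) : ℝ :=
  ∑ a : m, ∑ b : m, A a b * B a b

/-- The indicator vector `e_α`, padded with a zero at the extra index. -/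
def indVec {d : ℕ} {n : Fin d → ℕ} (α : Idx n) : Option (Idx n) → ℝ :=
  fun o => if o = some α then 1 else 0

/-- The matrix `A_α = [-T^ε_α; e_α][-T^ε_α; e_α]ᵀ`. -/
noncomputable def Amat {d : ℕ} {n : Fin d → ℕ} (Teps : Idx n → ℝ) (α : Idx n) :
    Matrix (Option (Idx n)) (Option (Idx n)) ℝ :=
  Matrix.vecMulVec (fun o => Option.elim o (-Teps α) (fun β => if β = α then 1 else 0))
    (fun o => Option.elim o (-Teps α) (fun β => if β = α then 1 else 0))

/-- The (padded) matrix `E_{α,β} = e_α e_βᵀ + e_β e_αᵀ`. -/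
noncomputable def Ebig {d : ℕ} {n : Fin d → ℕ} (a b : Idx n) :
    Matrix (Option (Idx n)) (Option (Idx n)) ℝ :=
  Matrix.vecMulVec (indVec a) (indVec b) + Matrix.vecMulVec (indVec b) (indVec a)

/-- The matrix `[[1,0],[0,0]]`. -/
def E00 {d : ℕ} {n : Fin d → ℕ} : Matrix (Option (Idx n)) (Option (Idx n)) ℝ :=
  Matrix.of fun a b => if a = none ∧ b = none then 1 else 0

/-- The matrix `[[0,0],[0,I_N]]`. -/
def Ibot {d : ℕ} {n : Fin d → ℕ} : Matrix (Option (Idx n)) (Option (Idx n)) ℝ :=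
  1 - E00

open Classical in
/-- The dual slack matrix of (dSDP-N) associated to data `(ρ, μ)`. -/
noncomputable def dualNMatrix {d : ℕ} {n : Fin d → ℕ} (Ω : Finset (Idx n))
    (Teps : Idx n → ℝ) (c ρ : ℝ) (μ : Idx n → Idx n → Idx n → Idx n → ℝ) :
    Matrix (Option (Idx n)) (Option (Idx n)) ℝ :=
  Ibot - ρ • E00 + c • (∑ α ∈ Ω, Amat Teps α) -
    ∑ a : Idx n, ∑ b : Idx n, ∑ cc : Idx n, ∑ e : Idx n,
      (if IsSquare a b cc e then (μ a b cc e / 2) • (Ebig a b - Ebig cc e) else 0)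

/-- Dual feasibility for (dSDP-N): `Q` is PSD and has the prescribed dual form. -/
def DualNFeasible {d : ℕ} {n : Fin d → ℕ} (Ω : Finset (Idx n)) (Teps : Idx n → ℝ)
    (c : ℝ) (Q : Matrix (Option (Idx n)) (Option (Idx n)) ℝ) : Prop :=
  Q.PosSemidef ∧ ∃ (ρ : ℝ) (μ : Idx n → Idx n → Idx n → Idx n → ℝ),
    Q = dualNMatrix Ω Teps c ρ μ

/-! ### Level-based weights (Algorithm 1) -/

/-- Cumulative level sets: level 0 is `𝒫_SR(Ω)`; each next level adds the tuples
completing a square with three previously reached tuples. -/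
def srLevelSet {d : ℕ} {n : Fin d → ℕ} (Ω : Set (Idx n)) : ℕ → Set (Idx n)
  | 0 => {β | PSR Ω β}
  | (ℓ + 1) => srLevelSet Ω ℓ ∪ {β | ∃ a b c : Idx n,
      a ∈ srLevelSet Ω ℓ ∧ b ∈ srLevelSet Ω ℓ ∧ c ∈ srLevelSet Ω ℓ ∧ IsSquare a b c β}

/-- The level-based weight vector `w(ϑ)`: `w(ϑ)_β = ϑ^ℓ` where `ℓ` is the first level
containing `β`. -/
noncomputable def levelWeight {d : ℕ} {n : Fin d → ℕ} (Ω : Set (Idx n)) (θ : ℝ)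
    (β : Idx n) : ℝ :=
  θ ^ sInf {ℓ : ℕ | β ∈ srLevelSet Ω ℓ}

/-! ### Random masks -/

/-- The Bernoulli measure on `Bool` with success probability `p`. -/
noncomputable def bern (p : ℝ) : Measure Bool :=
  (ENNReal.ofReal p) • Measure.dirac true + (ENNReal.ofReal (1 - p)) • Measure.dirac false


theorem vF2_eq_sum_single {d : ℕ} {n : Fin d → ℕ} (α : Idx n) :
    vF2 α = ∑ i, Pi.single (⟨i, α i⟩ : Σ i : Fin d, Fin (n i)) (1 : ZMod 2) := by
  ext ⟨i, j⟩
  rw [Finset.sum_apply, Finset.sum_eq_single i]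
  · by_cases h : α i = j
    · subst h; simp [vF2]
    · have h' : j ≠ α i := fun e => h e.symm
      simp [vF2, h, h']
  · intro k _ hk
    have : (⟨i, j⟩ : Σ i : Fin d, Fin (n i)) ≠ ⟨k, α k⟩ :=
      fun h' => hk (congrArg Sigma.fst h').symm
    exact Pi.single_eq_of_ne this _
  · simp

/-- The sum of the entries of `y` selected by the tuple `α`. -/
def entrySum {d : ℕ} {n : Fin d → ℕ} {G : Type*} [AddCommGroup G]
    (y : ∀ i : Fin d, Fin (n i) → G) (α : Idx n) : G :=
  ∑ i, y i (α i)

theorem entrySum_eq_double_sum {d : ℕ} {n : Fin d → ℕ} {G : Type*} [AddCommGroup G]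
    (y : ∀ i : Fin d, Fin (n i) → G) (α : Idx n) :
    entrySum y α = ∑ i, ∑ j, (if α i = j then (1 : ℤ) else 0) • y i j := by
  simp [entrySum, ite_smul]

/-- The base tuple, all of whose coordinates are the first index. -/
def baseIdx {d : ℕ} {n : Fin d → ℕ} (hn : ∀ i, 0 < n i) : Idx n := fun i => ⟨0, hn i⟩

theorem entrySum_update {d : ℕ} {n : Fin d → ℕ} {G : Type*} [AddCommGroup G]
    (y : ∀ i : Fin d, Fin (n i) → G) (α : Idx n) (i : Fin d) (j : Fin (n i)) :
    entrySum y (Function.update α i j) - entrySum y α = y i j - y i (α i) := by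
  unfold entrySum
  rw [← Finset.sum_sub_distrib, Finset.sum_eq_single i]
  · simp
  · intro k _ hk
    simp [Function.update_of_ne hk]
  · simp

/-- An integer combination of the entries of `y` whose blocks have equal coefficient sums lies
in the subgroup generated by the entry sums over all tuples. -/
theorem sum_zsmul_mem_span_entrySum {d : ℕ} {n : Fin d → ℕ} (hn : ∀ i, 0 < n i)
    {G : Type*} [AddCommGroup G] (y : ∀ i : Fin d, Fin (n i) → G)
    (w : ∀ i : Fin d, Fin (n i) → ℤ) (c : ℤ) (hw : ∀ i, ∑ j, w i j = c) :
    ∑ i, ∑ j, w i j • y i j ∈ Submodule.span ℤ (Set.range (entrySum y)) := by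
  have key : ∑ i, ∑ j, w i j • y i j = c • entrySum y (baseIdx hn) +
      ∑ i, ∑ j, w i j • (entrySum y (Function.update (baseIdx hn) i j)
        - entrySum y (baseIdx hn)) := by
    simp only [entrySum_update, smul_sub, Finset.sum_sub_distrib, ← Finset.sum_smul, hw]
    simp [entrySum, Finset.smul_sum]
  have hmem : ∀ α, entrySum y α ∈ Submodule.span ℤ (Set.range (entrySum y)) :=
    fun α => Submodule.subset_span ⟨α, rfl⟩
  rw [key]
  exact add_mem (Submodule.smul_mem _ _ (hmem _)) (Submodule.sum_mem _ fun i _ =>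
    Submodule.sum_mem _ fun j _ => Submodule.smul_mem _ _ (sub_mem (hmem _) (hmem _)))

/-- If `v_β` lies in the span of the observed rows and the observed entry sums vanish, then the
entry sum over `β` is twice an element of the subgroup generated by all entry sums. -/
theorem exists_entrySum_eq_two_smul {d : ℕ} (hd : 0 < d) {n : Fin d → ℕ} (hn : ∀ i, 0 < n i)
    {Ω : Finset (Idx n)} {G : Type*} [AddCommGroup G] (y : ∀ i : Fin d, Fin (n i) → G)
    (hy : ∀ α ∈ Ω, entrySum y α = 0) (β : Idx n)
    (hβ : vF2 β ∈ Submodule.span (ZMod 2) (vF2 '' (Ω : Set (Idx n)))) :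
    ∃ g ∈ Submodule.span ℤ (Set.range (entrySum y)), entrySum y β = (2 : ℤ) • g := by
  obtain ⟨c, hc⟩ := (Submodule.mem_span_image_finset_iff_exists_fun' (ZMod 2)).1 hβ
  have hdvd : ∀ i (j : Fin (n i)), ∃ w : ℤ, (if β i = j then (1 : ℤ) else 0) -
      ∑ α ∈ Ω, ((c α).val : ℤ) * (if α i = j then 1 else 0) = 2 * w := by
    intro i j
    refine (ZMod.intCast_zmod_eq_zero_iff_dvd _ 2).1 ?_
    have h := congrFun hc ⟨i, j⟩
    simp only [Finset.sum_apply, Pi.smul_apply, vF2, smul_eq_mul] at h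
    push_cast
    simp only [ZMod.natCast_val, ZMod.cast_id', id_eq]
    rw [h, sub_self]
  choose w hw using hdvd
  have hsum : ∀ i, 2 * ∑ j, w i j = 1 - ∑ α ∈ Ω, ((c α).val : ℤ) := by
    intro i
    rw [Finset.mul_sum]
    simp only [← hw, Finset.sum_sub_distrib]
    rw [Finset.sum_comm]
    simp
  refine ⟨∑ i, ∑ j, w i j • y i j,
    sum_zsmul_mem_span_entrySum hn y w (∑ j, w ⟨0, hd⟩ j) (fun i => ?_), ?_⟩
  · have := hsum i
    have := hsum ⟨0, hd⟩
    lia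
  · have h0 : ∑ α ∈ Ω, ((c α).val : ℤ) • entrySum y α = 0 :=
      Finset.sum_eq_zero fun α hα => by rw [hy α hα, smul_zero]
    rw [← sub_zero (entrySum y β), ← h0]
    simp only [entrySum_eq_double_sum, Finset.smul_sum, smul_smul, ← hw, sub_smul,
      Finset.sum_sub_distrib, Finset.sum_smul]
    congr 1
    rw [Finset.sum_comm]
    exact Finset.sum_congr rfl fun i _ => Finset.sum_comm

/-- In a group without odd torsion, entry sums vanishing on a spanning mask vanish everywhere. -/
theorem entrySum_eq_zero {d : ℕ} (hd : 0 < d) {n : Fin d → ℕ} (hn : ∀ i, 0 < n i)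
    {Ω : Finset (Idx n)} {G : Type*} [AddCommGroup G]
    (hG : ∀ (r : ℤ) (g : G), Odd r → r • g = 0 → g = 0)
    (hΩ : ∀ β : Idx n, vF2 β ∈ Submodule.span (ZMod 2) (vF2 '' (Ω : Set (Idx n))))
    (y : ∀ i : Fin d, Fin (n i) → G) (hy : ∀ α ∈ Ω, entrySum y α = 0) (β : Idx n) :
    entrySum y β = 0 := by
  set A := Submodule.span ℤ (Set.range (entrySum y)) with hA
  have hle : A ≤ Ideal.span {(2 : ℤ)} • A := by
    rw [hA, Submodule.span_le]
    rintro _ ⟨β, rfl⟩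
    obtain ⟨g, hg, h⟩ := exists_entrySum_eq_two_smul hd hn y hy β (hΩ β)
    rw [h]
    exact Submodule.smul_mem_smul (Ideal.mem_span_singleton_self 2) hg
  obtain ⟨r, hr, hrA⟩ := Submodule.exists_sub_one_mem_and_smul_eq_zero_of_fg_of_le_smul
    (Ideal.span {(2 : ℤ)}) A (Submodule.fg_span (Set.finite_range _)) hle
  obtain ⟨k, hk⟩ := Ideal.mem_span_singleton.1 hr
  exact hG r _ ⟨k, by lia⟩ (hrA _ (Submodule.subset_span ⟨β, rfl⟩))

theorem units_real_eq_one_of_odd_zpow (r : ℤ) (x : ℝˣ) (hr : Odd r) (h : x ^ r = 1) : x = 1 := by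
  have h1 : x ^ r.natAbs = 1 := by
    rcases Int.natAbs_eq r with h' | h' <;> rw [h'] at h <;> simpa using h
  have h2 : (x : ℝ) ^ r.natAbs = 1 ^ r.natAbs := by
    rw [one_pow, ← Units.val_pow_eq_pow_val, h1, Units.val_one]
  exact Units.ext ((Int.natAbs_odd.2 hr).pow_injective h2)

theorem uniqueRecovery_of_mem_span {d : ℕ} (hd : 0 < d) {n : Fin d → ℕ} (hn : ∀ i, 0 < n i)
    {Ω : Finset (Idx n)}
    (hΩ : ∀ β : Idx n, vF2 β ∈ Submodule.span (ZMod 2) (vF2 '' (Ω : Set (Idx n)))) :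
    UniqueRecovery (Ω : Set (Idx n)) := by
  rintro That hT T ⟨⟨u, hu⟩, hTu⟩ T' ⟨⟨u', hu'⟩, hTu'⟩
  have hcov : ∀ i (j : Fin (n i)), ∃ α ∈ Ω, α i = j := by
    intro i j
    by_contra! hne
    have h0 : Submodule.span (ZMod 2) (vF2 '' (Ω : Set (Idx n))) ≤
        LinearMap.ker (LinearMap.proj ⟨i, j⟩) := by
      rw [Submodule.span_le]
      rintro _ ⟨α, hα, rfl⟩
      simp [vF2, hne α hα]
    have := h0 (hΩ (Function.update (baseIdx hn) i j))
    simp [vF2] at this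
  have hne : ∀ (v : ∀ i : Fin d, Fin (n i) → ℝ), (∀ α ∈ Ω, ∏ i, v i (α i) ≠ 0) →
      ∀ i j, v i j ≠ 0 := by
    intro v hv i j
    obtain ⟨α, hα, rfl⟩ := hcov i j
    exact Finset.prod_ne_zero_iff.1 (hv α hα) i (Finset.mem_univ i)
  have hu0 := hne u fun α hα => by rw [← hu, hTu α hα]; exact hT α hα
  have hu0' := hne u' fun α hα => by rw [← hu', hTu' α hα]; exact hT α hα
  let q : ∀ i : Fin d, Fin (n i) → Additive ℝˣ := fun i j =>
    Additive.ofMul (Units.mk0 (u i j) (hu0 i j) / Units.mk0 (u' i j) (hu0' i j))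
  have hq : ∀ α, entrySum q α = 0 ↔ T α = T' α := by
    intro α
    have h1 : T' α ≠ 0 := by
      rw [hu']; exact Finset.prod_ne_zero_iff.2 fun i _ => hu0' i _
    have h2 : ((entrySum q α).toMul : ℝ) = T α / T' α := by
      simp [entrySum, q, hu, hu', toMul_sum, Units.coe_prod]
    rw [← div_eq_one_iff_eq h1, ← h2, Units.val_eq_one, toMul_eq_one]
  funext β
  exact (hq β).1 (entrySum_eq_zero hd hn
    (fun r g hr hg => units_real_eq_one_of_odd_zpow r g.toMul hr hg) hΩ q
    (fun α hα => (hq α).2 ((hTu α hα).trans (hTu' α hα).symm)) β)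

/-- The sign character of `ZMod 2`. -/
def signChar (a : ZMod 2) : ℝ := if a = 0 then 1 else -1

theorem signChar_eq_one {a : ZMod 2} : signChar a = 1 ↔ a = 0 := by
  unfold signChar
  split_ifs with h
  · simp [h]
  · simp only [h, iff_false]; norm_num

theorem signChar_add (a b : ZMod 2) : signChar (a + b) = signChar a * signChar b := by
  have h : (a = 0 ∨ a = 1) ∧ (b = 0 ∨ b = 1) := by revert a b; decide
  have h2 : (1 : ZMod 2) + 1 = 0 := by decide
  rcases h with ⟨rfl | rfl, rfl | rfl⟩ <;> simp [signChar, h2]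

theorem signChar_sum {ι : Type*} (s : Finset ι) (f : ι → ZMod 2) :
    signChar (∑ i ∈ s, f i) = ∏ i ∈ s, signChar (f i) := by
  classical
  induction s using Finset.induction_on with
  | empty => simp [signChar]
  | insert a s ha ih => rw [Finset.sum_insert ha, Finset.prod_insert ha, signChar_add, ih]

theorem mem_span_of_uniqueRecovery {d : ℕ} {n : Fin d → ℕ} {Ω : Finset (Idx n)}
    (hΩ : UniqueRecovery (Ω : Set (Idx n))) (β : Idx n) :
    vF2 β ∈ Submodule.span (ZMod 2) (vF2 '' (Ω : Set (Idx n))) := by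
  by_contra hβ
  obtain ⟨f, hfβ, hf⟩ := Submodule.exists_le_ker_of_notMem hβ
  have hone : IsRankOne (fun _ : Idx n => (1 : ℝ)) := ⟨fun _ _ => 1, by simp⟩
  have hsign : IsRankOne (fun α : Idx n => signChar (f (vF2 α))) :=
    ⟨fun i j => signChar (f (Pi.single ⟨i, j⟩ 1)), fun α => by
      simp only [vF2_eq_sum_single, map_sum, signChar_sum]⟩
  have h := hΩ (fun _ => 1) (fun _ _ => one_ne_zero)
    ⟨hsign, fun α hα => signChar_eq_one.2 (hf (Submodule.subset_span ⟨α, hα, rfl⟩))⟩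
    ⟨hone, fun _ _ => rfl⟩
  exact hfβ (signChar_eq_one.1 (congrFun h β))

/-- The base vector together with the differences of unit vectors inside each block. -/
def blockBasis {d : ℕ} {n : Fin d → ℕ} (hn : ∀ i, 0 < n i) :
    Option (Σ i : Fin d, {j : Fin (n i) // j ≠ baseIdx hn i}) →
      (Σ i : Fin d, Fin (n i)) → ZMod 2
  | none => vF2 (baseIdx hn)
  | some s => vF2 (Function.update (baseIdx hn) s.1 s.2) - vF2 (baseIdx hn)

theorem blockBasis_some_apply {d : ℕ} {n : Fin d → ℕ} (hn : ∀ i, 0 < n i)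
    (s t : Σ i : Fin d, {j : Fin (n i) // j ≠ baseIdx hn i}) :
    blockBasis hn (some s) ⟨t.1, t.2⟩ = if s = t then 1 else 0 := by
  obtain ⟨i, j, hj⟩ := s
  obtain ⟨k, l, hl⟩ := t
  by_cases hik : i = k
  · subst hik
    simp [blockBasis, vF2, hl.symm]
  · have hki : k ≠ i := fun h => hik h.symm
    simp [blockBasis, vF2, Function.update_of_ne hki, hik]

theorem linearIndependent_blockBasis {d : ℕ} (hd : 0 < d) {n : Fin d → ℕ} (hn : ∀ i, 0 < n i) :
    LinearIndependent (ZMod 2) (blockBasis hn) := by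
  rw [Fintype.linearIndependent_iff]
  intro g hg
  have hsome : ∀ t, g (some t) = 0 := by
    intro t
    have h := congrFun hg ⟨t.1, t.2⟩
    have h0 : blockBasis hn none ⟨t.1, t.2⟩ = 0 := by
      simp [blockBasis, vF2, t.2.2.symm]
    simpa [Fintype.sum_option, Finset.sum_apply, blockBasis_some_apply, h0] using h
  rintro (_ | t)
  · have h := congrFun hg ⟨⟨0, hd⟩, baseIdx hn _⟩
    simpa [Fintype.sum_option, hsome, blockBasis, vF2] using h
  · exact hsome t

theorem span_range_blockBasis {d : ℕ} {n : Fin d → ℕ} (hn : ∀ i, 0 < n i) :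
    Submodule.span (ZMod 2) (Set.range (blockBasis hn)) =
      Submodule.span (ZMod 2) (Set.range (vF2 (n := n))) := by
  apply le_antisymm
  · rw [Submodule.span_le]
    rintro _ ⟨_ | s, rfl⟩
    · exact Submodule.subset_span ⟨_, rfl⟩
    · exact sub_mem (Submodule.subset_span ⟨_, rfl⟩) (Submodule.subset_span ⟨_, rfl⟩)
  · rw [Submodule.span_le]
    rintro _ ⟨α, rfl⟩
    have hdiff : ∀ i (j : Fin (n i)), vF2 (Function.update (baseIdx hn) i j) - vF2 (baseIdx hn) ∈
        Submodule.span (ZMod 2) (Set.range (blockBasis hn)) := by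
      intro i j
      by_cases hj : j = baseIdx hn i
      · simp [hj]
      · exact Submodule.subset_span ⟨some ⟨i, j, hj⟩, rfl⟩
    have hα : vF2 α = vF2 (baseIdx hn) +
        ∑ i, (vF2 (Function.update (baseIdx hn) i (α i)) - vF2 (baseIdx hn)) := by
      have hE : ∀ γ : Idx n, vF2 γ = entrySum
          (fun i j => Pi.single (⟨i, j⟩ : Σ i : Fin d, Fin (n i)) (1 : ZMod 2)) γ :=
        vF2_eq_sum_single
      simp only [hE, entrySum_update, Finset.sum_sub_distrib]
      simp [entrySum]
    rw [hα]
    exact add_mem (Submodule.subset_span ⟨none, rfl⟩)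
      (Submodule.sum_mem _ fun i _ => hdiff i (α i))

theorem finrank_span_range_vF2 {d : ℕ} (hd : 0 < d) {n : Fin d → ℕ} (hn : ∀ i, 0 < n i) :
    Module.finrank (ZMod 2) (Submodule.span (ZMod 2) (Set.range (vF2 (n := n)))) =
      (∑ i : Fin d, n i) - d + 1 := by
  rw [← span_range_blockBasis hn, finrank_span_eq_card (linearIndependent_blockBasis hd hn)]
  have h : ∑ i, (n i - 1) + d = ∑ i, n i := by
    calc ∑ i, (n i - 1) + d = ∑ i, (n i - 1 + 1) := by simp [Finset.sum_add_distrib]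
      _ = _ := Finset.sum_congr rfl fun i _ => Nat.sub_add_cancel (hn i)
  simp only [Fintype.card_option, Fintype.card_sigma, ne_eq, Fintype.card_subtype_compl,
    Fintype.card_fin, Fintype.card_unique]
  lia

theorem rank_maskMatrix {d : ℕ} {n : Fin d → ℕ} (Ω : Finset (Idx n)) :
    (maskMatrix Ω).rank =
      Module.finrank (ZMod 2) (Submodule.span (ZMod 2) (vF2 '' (Ω : Set (Idx n)))) := by
  rw [Matrix.rank_eq_finrank_span_row, Set.image_eq_range]
  rfl

/-- `Ω` satisfies unique recovery iff the 𝔽₂ matrix `V_Ω` has rank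
`n - d + 1`. -/
theorem statement0 {d : ℕ} (hd : 0 < d) {n : Fin d → ℕ} (hn : ∀ i, 0 < n i)
    (Ω : Finset (Idx n)) :
    UniqueRecovery (↑Ω : Set (Idx n)) ↔
      (maskMatrix Ω).rank = (∑ i : Fin d, n i) - d + 1 := by
  have hle : Submodule.span (ZMod 2) (vF2 '' (Ω : Set (Idx n))) ≤
      Submodule.span (ZMod 2) (Set.range vF2) := Submodule.span_mono (Set.image_subset_range _ _)
  rw [rank_maskMatrix, ← finrank_span_range_vF2 hd hn]
  constructor
  · intro h
    have hge : Submodule.span (ZMod 2) (Set.range vF2) ≤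
        Submodule.span (ZMod 2) (vF2 '' (Ω : Set (Idx n))) := by
      rw [Submodule.span_le]
      rintro _ ⟨β, rfl⟩
      exact mem_span_of_uniqueRecovery h β
    rw [le_antisymm hle hge]
  · intro h
    refine uniqueRecovery_of_mem_span hd hn fun β => ?_
    rw [Submodule.eq_of_le_of_finrank_eq hle h]
    exact Submodule.subset_span ⟨β, rfl⟩

end RankOneTC
end

section
/- If an observation mask Ω ⊆ ⟦N⟧ satisfies GS-propagation, then Ω satisfies unique recovery. -/
namespace RankOneTC

open scoped BigOperators
open MeasureTheory

/-- If the indicators of four elements sum to zero over `𝔽₂`, the elements pair up. -/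
lemma pairing_of_indicator_sum_eq_zero {ι : Type*} [DecidableEq ι] {a b c e : ι}
    (h : ∀ j, (if a = j then (1 : ZMod 2) else 0) + (if b = j then 1 else 0) +
      (if c = j then 1 else 0) + (if e = j then 1 else 0) = 0) :
    (e = a ∧ b = c) ∨ (e = b ∧ a = c) ∨ (e = c ∧ a = b) := by
  have h1 : (1 : ZMod 2) ≠ 0 := by decide
  have h3 : (1 : ZMod 2) + 1 + 1 ≠ 0 := by decide
  have ha := h a
  have hb := h b
  have hc := h c
  have he := h e
  grind

lemma IsGenSquare.pairing {d : ℕ} {n : Fin d → ℕ} {α₁ α₂ α₃ β : Idx n}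
    (h : IsGenSquare α₁ α₂ α₃ β) (k : Fin d) :
    (β k = α₁ k ∧ α₂ k = α₃ k) ∨ (β k = α₂ k ∧ α₁ k = α₃ k) ∨
      (β k = α₃ k ∧ α₁ k = α₂ k) :=
  pairing_of_indicator_sum_eq_zero fun j => by
    simpa [vF2] using congrFun h.2 ⟨k, j⟩

/-- The product of a rank-one tensor over a generalized square is the square of a product of
two entries, at positions that depend only on the generalized square. -/
lemma IsGenSquare.exists_prod_eq_sq {d : ℕ} {n : Fin d → ℕ} {α₁ α₂ α₃ β : Idx n}
    (h : IsGenSquare α₁ α₂ α₃ β) :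
    ∃ γ δ : Idx n, ∀ T : Idx n → ℝ, IsRankOne T →
      T α₁ * T α₂ * T α₃ * T β = (T γ * T δ) ^ 2 := by
  have hk : ∀ k : Fin d, ∃ a b : Fin (n k), ∀ g : Fin (n k) → ℝ,
      g (α₁ k) * g (α₂ k) * g (α₃ k) * g (β k) = (g a * g b) ^ 2 := by
    intro k
    rcases h.pairing k with ⟨h₁, h₂⟩ | ⟨h₁, h₂⟩ | ⟨h₁, h₂⟩
    · exact ⟨α₁ k, α₃ k, fun g => by rw [h₁, h₂]; ring⟩
    · exact ⟨α₂ k, α₃ k, fun g => by rw [h₁, h₂]; ring⟩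
    · exact ⟨α₃ k, α₂ k, fun g => by rw [h₁, h₂]; ring⟩
  choose γ δ hγδ using hk
  refine ⟨γ, δ, ?_⟩
  rintro T ⟨u, hu⟩
  simp only [hu, ← Finset.prod_mul_distrib, ← Finset.prod_pow]
  exact Finset.prod_congr rfl fun k _ => hγδ k (u k)

lemma IsRankOne.ne_zero_of_isGenSquare {d : ℕ} {n : Fin d → ℕ} {T : Idx n → ℝ}
    (hT : IsRankOne T) {α₁ α₂ α₃ β : Idx n} (h : IsGenSquare α₁ α₂ α₃ β)
    (h₁ : T α₁ ≠ 0) (h₂ : T α₂ ≠ 0) (h₃ : T α₃ ≠ 0) : T β ≠ 0 := by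
  obtain ⟨u, hu⟩ := hT
  simp only [hu, Finset.prod_ne_zero_iff, Finset.mem_univ, true_imp_iff] at *
  intro k
  rcases h.pairing k with ⟨e, -⟩ | ⟨e, -⟩ | ⟨e, -⟩ <;> rw [e]
  exacts [h₁ k, h₂ k, h₃ k]

lemma IsRankOne.ne_zero_of_gsPropagation {d : ℕ} {n : Fin d → ℕ} {T : Idx n → ℝ}
    (hT : IsRankOne T) {Ω : Set (Idx n)} (h : GSPropagation Ω) (h₀ : ∀ α ∈ Ω, T α ≠ 0)
    (β : Idx n) : T β ≠ 0 := by
  induction h β with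
  | base hα => exact h₀ _ hα
  | prop hsq _ _ _ h₁ h₂ h₃ => exact hT.ne_zero_of_isGenSquare hsq h₁ h₂ h₃

/-- A finite family of elements of a torsion-free abelian group all of which are doubles in the
subgroup they generate vanishes. -/
lemma eq_zero_of_mem_two_smul_span {ι M : Type*} [Finite ι] [AddCommGroup M]
    [Module.IsTorsionFree ℤ M] (f : ι → M)
    (h : ∀ i, f i ∈ Ideal.span {(2 : ℤ)} • Submodule.span ℤ (Set.range f)) (i : ι) :
    f i = 0 := by
  obtain ⟨r, hr, hr0⟩ := Submodule.exists_sub_one_mem_and_smul_eq_zero_of_fg_of_le_smul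
    (Ideal.span {(2 : ℤ)}) (Submodule.span ℤ (Set.range f))
    (Submodule.fg_span (Set.finite_range f))
    (Submodule.span_le.2 (Set.range_subset_iff.2 h))
  have hrne : r ≠ 0 := by
    rw [Ideal.mem_span_singleton] at hr
    omega
  exact (smul_eq_zero.1 (hr0 _ (Submodule.subset_span ⟨i, rfl⟩))).resolve_left hrne

/-- Rank-one tensors that agree, with nonzero entries, on a GS-propagating mask have entries of
equal absolute value. -/
lemma IsRankOne.abs_eq_abs_of_gsPropagation {d : ℕ} {n : Fin d → ℕ} {S T : Idx n → ℝ}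
    (hS : IsRankOne S) (hT : IsRankOne T) {Ω : Set (Idx n)} (h : GSPropagation Ω)
    (hS₀ : ∀ α, S α ≠ 0) (hT₀ : ∀ α, T α ≠ 0) (hST : ∀ α ∈ Ω, S α = T α) (β : Idx n) :
    |S β| = |T β| := by
  set f : Idx n → ℝ := fun α => Real.log (S α) - Real.log (T α) with hf
  have hlog (U : Idx n → ℝ) (hU : ∀ α, U α ≠ 0) {α₁ α₂ α₃ α₄ γ δ : Idx n}
      (e : U α₁ * U α₂ * U α₃ * U α₄ = (U γ * U δ) ^ 2) :
      Real.log (U α₁) + Real.log (U α₂) + Real.log (U α₃) + Real.log (U α₄) =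
        2 * (Real.log (U γ) + Real.log (U δ)) := by
    have := congrArg Real.log e
    rwa [Real.log_mul (by simp [hU]) (hU _), Real.log_mul (by simp [hU]) (hU _),
      Real.log_mul (hU _) (hU _), Real.log_pow, Real.log_mul (hU _) (hU _),
      Nat.cast_two] at this
  have hmem : ∀ α, f α ∈ Ideal.span {(2 : ℤ)} • Submodule.span ℤ (Set.range f) := by
    intro α
    induction h α with
    | base hα => simp [hf, hST _ hα]
    | @prop α₁ α₂ α₃ β hsq _ _ _ h₁ h₂ h₃ =>
      obtain ⟨γ, δ, hγδ⟩ := hsq.exists_prod_eq_sq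
      have eS := hlog S hS₀ (hγδ S hS)
      have eT := hlog T hT₀ (hγδ T hT)
      have e : f β = (2 : ℤ) • (f γ + f δ) - f α₁ - f α₂ - f α₃ := by
        simp only [hf, zsmul_eq_mul, Int.cast_ofNat]
        linarith
      rw [e]
      refine sub_mem (sub_mem (sub_mem (Submodule.smul_mem_smul
        (Ideal.mem_span_singleton_self _) (add_mem ?_ ?_)) h₁) h₂) h₃
      · exact Submodule.subset_span ⟨γ, rfl⟩
      · exact Submodule.subset_span ⟨δ, rfl⟩
  have h0 := sub_eq_zero.1 (eq_zero_of_mem_two_smul_span f hmem β)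
  rw [← Real.log_abs (S β), ← Real.log_abs (T β)] at h0
  exact Real.log_injOn_pos (abs_pos.2 (hS₀ β)) (abs_pos.2 (hT₀ β)) h0

/-- GS-propagation implies unique recovery. -/
theorem statement1 {d : ℕ} {n : Fin d → ℕ} (Ω : Set (Idx n))
    (h : GSPropagation Ω) : UniqueRecovery Ω := by
  rintro That hne S ⟨hS, hSΩ⟩ T ⟨hT, hTΩ⟩
  have hST : ∀ α ∈ Ω, S α = T α := fun α hα => (hSΩ α hα).trans (hTΩ α hα).symm
  have hS₀ := hS.ne_zero_of_gsPropagation h fun α hα => hSΩ α hα ▸ hne α hα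
  have hT₀ := hT.ne_zero_of_gsPropagation h fun α hα => hTΩ α hα ▸ hne α hα
  have habs := hS.abs_eq_abs_of_gsPropagation hT h hS₀ hT₀ hST
  funext β
  induction h β with
  | base hα => exact hST _ hα
  | @prop α₁ α₂ α₃ β hsq _ _ _ h₁ h₂ h₃ =>
    obtain ⟨γ, δ, hγδ⟩ := hsq.exists_prod_eq_sq
    have e : T α₁ * T α₂ * T α₃ * S β = T α₁ * T α₂ * T α₃ * T β := by
      rw [hγδ T hT, ← h₁, ← h₂, ← h₃, hγδ S hS, mul_pow, mul_pow,
        sq_eq_sq_iff_abs_eq_abs _ _ |>.2 (habs γ), sq_eq_sq_iff_abs_eq_abs _ _ |>.2 (habs δ)]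
    exact mul_left_cancel₀ (mul_ne_zero (mul_ne_zero (hT₀ _) (hT₀ _)) (hT₀ _)) e

end RankOneTC
end

section
/- For d = 2 (matrix completion), the following are equivalent for an observation mask Ω ⊆ [n_1]×[n_2]: (i) Ω satisfies unique recovery; (ii) Ω satisfies GS-propagation; (iii) Ω satisfies S-propagation; (iv) Ω satisfies SR-propagation; (v) Ω satisfies A-propagation; (vi) the bipartite graph with vertex set {u_1,…,u_{n_1}} ∪ {v_1,…,v_{n_2}}, in which u_i and v_j are adjacent if and only if (i,j) ∈ Ω, is connected. -/
namespace RankOneTC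

open scoped BigOperators
open MeasureTheory

/-- The bipartite graph on `[n 0] ⊕ [n 1]` where `u_i ~ v_j` iff `(i,j) ∈ Ω`. -/
def maskGraph {n : Fin 2 → ℕ} (Ω : Set (Idx n)) :
    SimpleGraph (Fin (n 0) ⊕ Fin (n 1)) :=
  SimpleGraph.fromRel (fun a b =>
    ∃ (i : Fin (n 0)) (j : Fin (n 1)), a = Sum.inl i ∧ b = Sum.inr j ∧
      ∃ α ∈ Ω, α 0 = i ∧ α 1 = j)

section

variable {d : ℕ}

theorem IsSquare.eq_and_eq_or {n : Fin d → ℕ} {α₁ α₂ α₃ α₄ : Idx n}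
    (h : IsSquare α₁ α₂ α₃ α₄) (k : Fin d) :
    (α₁ k = α₃ k ∧ α₂ k = α₄ k) ∨ (α₁ k = α₄ k ∧ α₂ k = α₃ k) := by
  have := h.2 k
  grind

theorem IsSquare.mul_eq {n : Fin d → ℕ} {T : Idx n → ℝ} (hT : IsRankOne T)
    {α₁ α₂ α₃ α₄ : Idx n} (h : IsSquare α₁ α₂ α₃ α₄) : T α₁ * T α₂ = T α₃ * T α₄ := by
  obtain ⟨u, hu⟩ := hT
  simp only [hu, ← Finset.prod_mul_distrib]
  refine Finset.prod_congr rfl fun k _ => ?_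
  rcases h.eq_and_eq_or k with ⟨h₁, h₂⟩ | ⟨h₁, h₂⟩
  · rw [h₁, h₂]
  · rw [h₁, h₂, mul_comm]

theorem IsSquare.isGenSquare {n : Fin d → ℕ} {α₁ α₂ α₃ α₄ : Idx n}
    (h : IsSquare α₁ α₂ α₃ α₄) : IsGenSquare α₁ α₂ α₃ α₄ := by
  refine ⟨h.1, funext fun ⟨k, x⟩ => ?_⟩
  have key : ∀ a b : ZMod 2, a + b + a + b = 0 ∧ a + b + b + a = 0 := by decide
  simp only [vF2, Pi.add_apply, Pi.zero_apply]
  rcases h.eq_and_eq_or k with ⟨h₁, h₂⟩ | ⟨h₁, h₂⟩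
  · rw [h₁, h₂]
    exact (key _ _).1
  · rw [h₁, h₂]
    exact (key _ _).2

theorem SRPropagation.sPropagation {n : Fin d → ℕ} {Ω : Set (Idx n)} (h : SRPropagation Ω) :
    SPropagation Ω := by
  intro β
  induction h β with
  | base hα => exact .base hα
  | prop hs h₁ h₂ _ ih => exact .prop hs (.base h₁) ih (.base h₂)

theorem SPropagation.gsPropagation {n : Fin d → ℕ} {Ω : Set (Idx n)} (h : SPropagation Ω) :
    GSPropagation Ω := by
  intro β
  induction h β with
  | base hα => exact .base hα
  | prop hs _ _ _ ih₁ ih₂ ih₃ => exact .prop hs.isGenSquare ih₁ ih₂ ih₃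

theorem SPropagation.uniqueRecovery {n : Fin d → ℕ} {Ω : Set (Idx n)} (h : SPropagation Ω) :
    UniqueRecovery Ω := by
  rintro That hne T ⟨hT, hTΩ⟩ T' ⟨hT', hTΩ'⟩
  suffices ∀ β, T β = T' β ∧ T β ≠ 0 from funext fun β => (this β).1
  intro β
  induction h β with
  | base hα => exact ⟨(hTΩ _ hα).trans (hTΩ' _ hα).symm, hTΩ _ hα ▸ hne _ hα⟩
  | prop hs _ _ _ ih₁ ih₂ ih₃ =>
    have e := hs.mul_eq hT
    have e' := hs.mul_eq hT'
    rw [← ih₁.1, ← ih₂.1, ← ih₃.1] at e'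
    exact ⟨mul_left_cancel₀ ih₃.2 (e.symm.trans e'),
      right_ne_zero_of_mul (e ▸ mul_ne_zero ih₁.2 ih₂.2)⟩

/-- A linear functional of `v_α` over `𝔽₂` that vanishes on `Ω` vanishes on `𝒫_GS(Ω)`. -/
theorem PGS.sum_eq_zero {n : Fin d → ℕ} {Ω : Set (Idx n)} (f : (Σ i : Fin d, Fin (n i)) → ZMod 2)
    (hf : ∀ α ∈ Ω, ∑ i, f ⟨i, α i⟩ = 0) {β : Idx n} (hβ : PGS Ω β) :
    ∑ i, f ⟨i, β i⟩ = 0 := by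
  have dot (α : Idx n) : vF2 α ⬝ᵥ f = ∑ i, f ⟨i, α i⟩ := by
    simp [dotProduct, vF2, Fintype.sum_sigma]
  induction hβ with
  | base hα => exact hf _ hα
  | prop hs _ _ _ ih₁ ih₂ ih₃ =>
    have := congrArg (· ⬝ᵥ f) hs.2
    simpa only [add_dotProduct, zero_dotProduct, dot, ih₁, ih₂, ih₃, zero_add] using this

variable {n : Fin 2 → ℕ} {Ω : Set (Idx n)}

/-- The tuple `(i, j)`. -/
def pairIdx (i : Fin (n 0)) (j : Fin (n 1)) : Idx n
  | 0 => i
  | 1 => j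

theorem pairIdx_self (α : Idx n) : pairIdx (α 0) (α 1) = α := by
  funext k
  fin_cases k <;> rfl

theorem isSquare_pairIdx {i k : Fin (n 0)} {j l : Fin (n 1)} (hik : i ≠ k) (hjl : j ≠ l) :
    IsSquare (pairIdx i j) (pairIdx k l) (pairIdx i l) (pairIdx k j) := by
  have ne {a c : Fin (n 0)} {b e : Fin (n 1)} (h : a ≠ c ∨ b ≠ e) :
      pairIdx a b ≠ pairIdx c e :=
    fun he => h.elim (· (congrFun he 0)) (· (congrFun he 1))
  refine ⟨?_, fun m => ?_⟩
  · simp [ne (.inl hik), ne (.inr hjl), ne (.inl hik.symm), ne (.inr hjl.symm)]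
  · fin_cases m
    · exact ⟨rfl, rfl⟩
    · exact ⟨max_comm _ _, min_comm _ _⟩

theorem maskGraph_adj_of_mem {α : Idx n} (hα : α ∈ Ω) :
    (maskGraph Ω).Adj (.inl (α 0)) (.inr (α 1)) :=
  ⟨Sum.inl_ne_inr, .inl ⟨_, _, rfl, rfl, α, hα, rfl, rfl⟩⟩

/-- A property of vertices that is invariant along the edges is invariant under reachability. -/
theorem iff_of_maskGraph_reachable {P : Fin (n 0) ⊕ Fin (n 1) → Prop}
    (hP : ∀ α ∈ Ω, P (.inl (α 0)) ↔ P (.inr (α 1))) {x y : Fin (n 0) ⊕ Fin (n 1)}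
    (h : (maskGraph Ω).Reachable x y) : P x ↔ P y := by
  obtain ⟨w⟩ := h
  induction w with
  | nil => rfl
  | cons hadj _ ih =>
    refine Iff.trans ?_ ih
    rcases hadj.2 with ⟨_, _, rfl, rfl, α, hα, rfl, rfl⟩ | ⟨_, _, rfl, rfl, α, hα, rfl, rfl⟩
    · exact hP α hα
    · exact (hP α hα).symm

theorem maskGraph_connected_of_forall_iff (hn : ∀ i, 0 < n i)
    (h : ∀ P : Fin (n 0) ⊕ Fin (n 1) → Prop, (∀ α ∈ Ω, P (.inl (α 0)) ↔ P (.inr (α 1))) →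
      ∀ β : Idx n, P (.inl (β 0)) ↔ P (.inr (β 1))) : (maskGraph Ω).Connected := by
  have hreach (i : Fin (n 0)) (j : Fin (n 1)) :
      (maskGraph Ω).Reachable (.inl i) (.inr j) :=
    (h (fun y => (maskGraph Ω).Reachable (.inl i) y)
      (fun α hα => ⟨fun hr => hr.trans (maskGraph_adj_of_mem hα).reachable,
        fun hr => hr.trans (maskGraph_adj_of_mem hα).symm.reachable⟩) (pairIdx i j)).1 .rfl
  have : Nonempty (Fin (n 0) ⊕ Fin (n 1)) := ⟨.inl ⟨0, hn 0⟩⟩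
  have hbase (x : Fin (n 0) ⊕ Fin (n 1)) : (maskGraph Ω).Reachable (.inl ⟨0, hn 0⟩) x := by
    rcases x with i | j
    · exact (hreach _ ⟨0, hn 1⟩).trans (hreach i _).symm
    · exact hreach _ j
  exact ⟨fun x y => (hbase x).symm.trans (hbase y)⟩

theorem UniqueRecovery.maskGraph_connected (hn : ∀ i, 0 < n i) (h : UniqueRecovery Ω) :
    (maskGraph Ω).Connected := by
  classical
  refine maskGraph_connected_of_forall_iff hn fun P hP β => ?_
  let u : ∀ k : Fin 2, Fin (n k) → ℝ
    | 0 => fun i => if P (.inl i) then 2 else 1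
    | 1 => fun j => if P (.inr j) then 2⁻¹ else 1
  have hu : (fun α : Idx n => ∏ k, u k (α k)) = fun _ => 1 := by
    refine h (fun _ => 1) (fun _ _ => one_ne_zero) ⟨⟨u, fun _ => rfl⟩, fun α hα => ?_⟩
      ⟨⟨fun _ _ => 1, by simp⟩, fun _ _ => rfl⟩
    have := hP α hα
    by_cases hp : P (.inl (α 0)) <;> simp_all [Fin.prod_univ_two, u]
  have hβ := congrFun hu β
  simp only [Fin.prod_univ_two, u] at hβ
  split_ifs at hβ <;> norm_num at hβ <;> tauto

theorem GSPropagation.maskGraph_connected (hn : ∀ i, 0 < n i) (h : GSPropagation Ω) :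
    (maskGraph Ω).Connected := by
  classical
  refine maskGraph_connected_of_forall_iff hn fun P hP β => ?_
  let f : (Σ i : Fin 2, Fin (n i)) → ZMod 2
    | ⟨0, i⟩ => if P (.inl i) then 1 else 0
    | ⟨1, j⟩ => if P (.inr j) then 1 else 0
  have hβ := (h β).sum_eq_zero f fun α hα => by
    have := hP α hα
    by_cases hp : P (.inl (α 0)) <;> simp_all [Fin.sum_univ_two, f]; rfl
  simp only [Fin.sum_univ_two, f] at hβ
  by_cases h₀ : P (.inl (β 0)) <;> by_cases h₁ : P (.inr (β 1)) <;> simp [h₀, h₁] at hβ ⊢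

theorem APropagation.maskGraph_connected (hn : ∀ i, 0 < n i) (h : APropagation Ω) :
    (maskGraph Ω).Connected := by
  obtain ⟨p, α, hα, hsc, hcov⟩ := h
  refine maskGraph_connected_of_forall_iff hn fun P hP β => ?_
  obtain ⟨k₀, hk₀⟩ := hcov 0 (β 0)
  have hp : 0 < p := k₀.pos
  have key (k : Fin p) : P (.inl (α k 0)) ↔ P (.inl (α ⟨0, hp⟩ 0)) := by
    induction k using WellFoundedLT.induction with
    | ind k ih =>
      rcases Nat.eq_zero_or_pos (k : ℕ) with h0 | hpos
      · rw [show k = ⟨0, hp⟩ from Fin.ext h0]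
      · obtain ⟨i, hik, hcard⟩ := hsc k hpos
        rw [← ih i hik]
        obtain ⟨j, hj⟩ := Finset.card_pos.1 (Nat.one_pos.trans_eq hcard.symm)
        have hj := (Finset.mem_filter.1 hj).2
        fin_cases j
        · exact iff_of_eq (congrArg (fun i => P (.inl i)) hj)
        · rw [hP _ (hα k), hP _ (hα i)]
          exact iff_of_eq (congrArg (fun i => P (.inr i)) hj)
  obtain ⟨k₁, hk₁⟩ := hcov 1 (β 1)
  rw [← hk₀, ← hk₁, ← hP _ (hα k₁), key, key k₁]

theorem srPropagation_of_maskGraph_connected (hn : ∀ i, 0 < n i)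
    (h : (maskGraph Ω).Connected) : SRPropagation Ω := by
  intro β
  obtain ⟨α, hα, hαβ⟩ : ∃ α ∈ Ω, α 0 = β 0 := by
    by_contra! hne
    have := iff_of_maskGraph_reachable (P := fun x => x = .inl (β 0)) (Ω := Ω)
      (fun α hα => by simp [hne α hα]) (h.preconnected (.inl (β 0)) (.inr ⟨0, hn 1⟩))
    simp at this
  let P : Fin (n 0) ⊕ Fin (n 1) → Prop :=
    Sum.elim (fun i => ∃ l, pairIdx i l ∈ Ω ∧ PSR Ω (pairIdx (β 0) l))
      (fun l => PSR Ω (pairIdx (β 0) l))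
  have hP (γ : Idx n) (hγ : γ ∈ Ω) : P (.inl (γ 0)) ↔ P (.inr (γ 1)) := by
    rw [← pairIdx_self γ] at hγ
    refine ⟨fun ⟨l, hl, hβl⟩ => ?_, fun hr => ⟨γ 1, hγ, hr⟩⟩
    change PSR Ω (pairIdx (β 0) (γ 1))
    by_cases hlγ : γ 1 = l
    · rwa [hlγ]
    by_cases hβγ : γ 0 = β 0
    · rw [← hβγ]
      exact .base hγ
    · exact .prop (isSquare_pairIdx hβγ hlγ) hγ hl hβl
  have := (iff_of_maskGraph_reachable hP (h.preconnected (.inr (α 1)) (.inr (β 1)))).1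
    (PSR.base (by rwa [← hαβ, pairIdx_self]))
  rw [← pairIdx_self β]
  exact this

theorem StronglyConnected.snoc {n : Fin d → ℕ} {p : ℕ} {α : Fin p → Idx n}
    (h : StronglyConnected α) {β : Idx n} {i : Fin p}
    (hi : (Finset.univ.filter fun j : Fin d => β j = α i j).card = d - 1) :
    StronglyConnected (Fin.snoc (α := fun _ => Idx n) α β) := by
  intro k
  refine Fin.lastCases (fun _ => ⟨i.castSucc, Fin.castSucc_lt_last i, ?_⟩) (fun k hk => ?_) k
  · simpa using hi
  · obtain ⟨l, hl, hc⟩ := h k (by simpa using hk)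
    exact ⟨l.castSucc, by simpa using hl, by simpa using hc⟩

/-- The vertices of the mask graph met by a sequence of tuples. -/
def coveredVertices {p : ℕ} (α : Fin p → Idx n) : Set (Fin (n 0) ⊕ Fin (n 1)) :=
  {x | ∃ k, x = .inl (α k 0) ∨ x = .inr (α k 1)}

theorem card_agree_eq_one {α β : Idx n} (h : α ≠ β) {j : Fin 2} (hj : α j = β j) :
    (Finset.univ.filter fun j : Fin 2 => α j = β j).card = 2 - 1 := by
  rw [Nat.add_one_sub_one, Finset.card_eq_one]
  refine ⟨j, Finset.ext fun k => ?_⟩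
  simp only [Finset.mem_filter, Finset.mem_univ, true_and, Finset.mem_singleton]
  refine ⟨fun hk => ?_, fun hk => hk ▸ hj⟩
  by_contra hkj
  refine h (funext fun m => ?_)
  obtain rfl | rfl : m = k ∨ m = j := by omega
  · exact hk
  · exact hj

/-- A sequence whose vertices do not exhaust a connected mask graph can be extended. -/
theorem exists_coveredVertices_ssubset (h : (maskGraph Ω).Connected) {p : ℕ}
    {α : Fin p → Idx n} (hp : 0 < p) (hα : ∀ k, α k ∈ Ω) (hsc : StronglyConnected α)
    (hne : coveredVertices α ≠ Set.univ) :
    ∃ α' : Fin (p + 1) → Idx n, (∀ k, α' k ∈ Ω) ∧ StronglyConnected α' ∧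
      coveredVertices α ⊂ coveredVertices α' := by
  obtain ⟨γ, hγ, hiff⟩ : ∃ γ ∈ Ω,
      ¬(.inl (γ 0) ∈ coveredVertices α ↔ .inr (γ 1) ∈ coveredVertices α) := by
    by_contra! hall
    refine hne (Set.eq_univ_of_forall fun x => ?_)
    exact (iff_of_maskGraph_reachable (P := (· ∈ coveredVertices α)) hall
      (h.preconnected (.inl (α ⟨0, hp⟩ 0)) x)).1 ⟨⟨0, hp⟩, .inl rfl⟩
  obtain ⟨i, j, hij, hγi⟩ : ∃ (i : Fin p) (j : Fin 2), γ j = α i j ∧ γ ≠ α i := by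
    have hneq (i) : γ ≠ α i := fun he =>
      hiff (iff_of_true ⟨i, .inl (by rw [he])⟩ ⟨i, .inr (by rw [he])⟩)
    by_cases h0 : .inl (γ 0) ∈ coveredVertices α
    · obtain ⟨i, hi⟩ := h0
      exact ⟨i, 0, by simpa using hi, hneq i⟩
    · obtain ⟨i, hi⟩ : .inr (γ 1) ∈ coveredVertices α := by tauto
      exact ⟨i, 1, by simpa using hi, hneq i⟩
  refine ⟨Fin.snoc (α := fun _ => Idx n) α γ, fun k => ?_,
    hsc.snoc (card_agree_eq_one hγi hij), ?_, fun hsub => hiff ?_⟩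
  · refine Fin.lastCases ?_ (fun k => ?_) k
    · simpa using hγ
    · simpa using hα k
  · rintro x ⟨k, hk⟩
    exact ⟨k.castSucc, by simpa using hk⟩
  · exact iff_of_true (hsub ⟨Fin.last p, .inl (by simp)⟩) (hsub ⟨Fin.last p, .inr (by simp)⟩)

theorem aPropagation_of_maskGraph_connected (hn : ∀ i, 0 < n i)
    (h : (maskGraph Ω).Connected) : APropagation Ω := by
  let S : Set (Set (Fin (n 0) ⊕ Fin (n 1))) := {C | ∃ (p : ℕ) (α : Fin p → Idx n),
    0 < p ∧ (∀ k, α k ∈ Ω) ∧ StronglyConnected α ∧ C = coveredVertices α}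
  have hS : S.Nonempty := by
    obtain ⟨α, hα⟩ : Ω.Nonempty := by
      by_contra! hΩ
      have := iff_of_maskGraph_reachable (Ω := Ω) (P := fun x => x.isLeft) (by simp [hΩ])
        (h.preconnected (.inl ⟨0, hn 0⟩) (.inr ⟨0, hn 1⟩))
      simp at this
    exact ⟨_, 1, fun _ => α, one_pos, fun _ => hα, fun k hk => by omega, rfl⟩
  obtain ⟨_, hmax⟩ := S.toFinite.exists_maximal hS
  obtain ⟨p, α, hp, hα, hsc, rfl⟩ := hmax.prop
  have hcov : coveredVertices α = Set.univ := by
    by_contra hne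
    obtain ⟨α', hα', hsc', hlt⟩ := exists_coveredVertices_ssubset h hp hα hsc hne
    exact hmax.not_gt ⟨p + 1, α', p.succ_pos, hα', hsc', rfl⟩ hlt
  refine ⟨p, α, hα, hsc, fun i j => ?_⟩
  match i, j with
  | 0, j =>
    obtain ⟨k, hk⟩ := hcov.ge (Set.mem_univ (Sum.inl j))
    exact ⟨k, by simpa [eq_comm] using hk⟩
  | 1, j =>
    obtain ⟨k, hk⟩ := hcov.ge (Set.mem_univ (Sum.inr j))
    exact ⟨k, by simpa [eq_comm] using hk⟩

end

/-- For `d = 2`, unique recovery, the four propagation conditions and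
connectedness of the associated bipartite graph are all equivalent. -/
theorem statement5 {n : Fin 2 → ℕ} (hn : ∀ i, 0 < n i) (Ω : Set (Idx n)) :
    List.TFAE
      [UniqueRecovery Ω, GSPropagation Ω, SPropagation Ω, SRPropagation Ω,
        APropagation Ω, (maskGraph Ω).Connected] := by

  tfae_have 1 → 6 := UniqueRecovery.maskGraph_connected hn
  tfae_have 6 → 4 := srPropagation_of_maskGraph_connected hn
  tfae_have 4 → 3 := SRPropagation.sPropagation
  tfae_have 3 → 2 := SPropagation.gsPropagation
  tfae_have 2 → 6 := GSPropagation.maskGraph_connected hn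
  tfae_have 3 → 1 := SPropagation.uniqueRecovery
  tfae_have 6 → 5 := aPropagation_of_maskGraph_connected hn
  tfae_have 5 → 6 := APropagation.maskGraph_connected hn
  tfae_finish

end RankOneTC
end

section
/- Assume Ω satisfies SR-propagation, the observed values T̂_α are nonzero for all α ∈ Ω, and there exists a rank-one tensor T with T_α = T̂_α for all α ∈ Ω. Then the semidefinite relaxation (SDP-E) is tight: the matrix 𝐗̄ built from the unique rank-one completion is the unique optimal solution of (SDP-E). -/
namespace RankOneTC

open scoped BigOperators
open MeasureTheory

lemma border_mulVec_single_sub {d : ℕ} {n : Fin d → ℕ} (x : Idx n → ℝ)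
    (X : Matrix (Idx n) (Idx n) ℝ) (α : Idx n) (b : Option (Idx n)) :
    (border x X).mulVec (Pi.single (some α) 1 - x α • Pi.single none 1) b =
      border x X b (some α) - x α * border x X b none := by
  simp [Matrix.mulVec_sub, Matrix.mulVec_smul]

lemma quadForm_border_single_sub {d : ℕ} {n : Fin d → ℕ} (x : Idx n → ℝ)
    (X : Matrix (Idx n) (Idx n) ℝ) (α : Idx n) :
    dotProduct (star (Pi.single (some α) 1 - x α • Pi.single none 1))
      ((border x X).mulVec (Pi.single (some α) 1 - x α • Pi.single none 1)) =
      X α α - x α ^ 2 := by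
  rw [star_trivial, sub_dotProduct, smul_dotProduct, single_one_dotProduct,
    single_one_dotProduct, border_mulVec_single_sub, border_mulVec_single_sub]
  simp only [border, Matrix.of_apply, smul_eq_mul]
  ring

lemma sq_le_diag_of_border_posSemidef {d : ℕ} {n : Fin d → ℕ} {x : Idx n → ℝ}
    {X : Matrix (Idx n) (Idx n) ℝ} (h : (border x X).PosSemidef) (α : Idx n) :
    x α ^ 2 ≤ X α α := by
  have := h.dotProduct_mulVec_nonneg (Pi.single (some α) 1 - x α • Pi.single none 1)
  rw [quadForm_border_single_sub] at this
  linarith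

lemma apply_eq_mul_of_diag_eq_sq {d : ℕ} {n : Fin d → ℕ} {x : Idx n → ℝ}
    {X : Matrix (Idx n) (Idx n) ℝ} (h : (border x X).PosSemidef) {α : Idx n}
    (hα : X α α = x α ^ 2) (β : Idx n) : X β α = x β * x α := by
  have h0 := (h.dotProduct_mulVec_zero_iff
    (Pi.single (some α) 1 - x α • Pi.single none 1)).1 (by
      rw [quadForm_border_single_sub, hα, sub_self])
  have hβ := congrFun h0 (some β)
  rw [border_mulVec_single_sub] at hβ
  simp only [border, Matrix.of_apply, Pi.zero_apply] at hβ
  linarith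

lemma IsRankOne.mul_eq_mul_of_isSquare {d : ℕ} {n : Fin d → ℕ} {T : Idx n → ℝ}
    (hT : IsRankOne T) {α₁ α₂ α₃ α₄ : Idx n} (h : IsSquare α₁ α₂ α₃ α₄) :
    T α₁ * T α₂ = T α₃ * T α₄ := by
  obtain ⟨u, hu⟩ := hT
  simp only [hu, ← Finset.prod_mul_distrib]
  refine Finset.prod_congr rfl fun k _ => ?_
  obtain ⟨hmax, hmin⟩ := h.2 k
  have key : (α₁ k = α₃ k ∧ α₂ k = α₄ k) ∨ (α₁ k = α₄ k ∧ α₂ k = α₃ k) := by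
    rcases le_total (α₁ k) (α₂ k) with h₁ | h₁ <;> rcases le_total (α₃ k) (α₄ k) with h₂ | h₂ <;>
      simp_all
  rcases key with ⟨h₁, h₂⟩ | ⟨h₁, h₂⟩ <;> rw [h₁, h₂]
  exact mul_comm _ _

lemma border_vecMulVec_self_posSemidef {d : ℕ} {n : Fin d → ℕ} (T : Idx n → ℝ) :
    (border T (Matrix.vecMulVec T T)).PosSemidef := by
  convert Matrix.posSemidef_vecMulVec_self_star (fun o : Option (Idx n) => o.elim 1 T) using 1
  ext (_ | a) (_ | b) <;> simp [border, Matrix.vecMulVec_apply]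

lemma SDPEFeasible.eq_of_SRPropagation {d : ℕ} {n : Fin d → ℕ} {Ω : Set (Idx n)}
    {That T x : Idx n → ℝ} {X : Matrix (Idx n) (Idx n) ℝ} (h : SDPEFeasible Ω That x X)
    (hSR : SRPropagation Ω) (hnz : ∀ α ∈ Ω, That α ≠ 0) (hT : IsRankOne T)
    (hTm : ∀ α ∈ Ω, T α = That α) : x = T := by
  have hcol : ∀ α ∈ Ω, ∀ β, X β α = x β * That α := fun α hα β => by
    rw [apply_eq_mul_of_diag_eq_sq h.psd (by rw [h.obsDiag α hα, h.obs α hα]), h.obs α hα]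
  funext β
  induction hSR β with
  | base hα => rw [h.obs _ hα, hTm _ hα]
  | @prop α₁ β α₂ γ hsq h₁ h₂ _ ih =>
    have hX := h.squares _ _ _ _ hsq
    rw [h.isSymm.apply β α₁, hcol _ h₁, h.isSymm.apply γ α₂, hcol _ h₂, ih] at hX
    have hTT := hT.mul_eq_mul_of_isSquare hsq
    rw [hTm _ h₁, hTm _ h₂] at hTT
    exact mul_right_cancel₀ (hnz _ h₂) (by linarith)

/-- Under SR-propagation and nonzero observations, the relaxation
(SDP-E) is tight: `𝐗̄` built from the rank-one completion is its unique optimal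
solution. -/
theorem statement8 {d : ℕ} {n : Fin d → ℕ} (Ω : Set (Idx n)) (That : Idx n → ℝ)
    (hSR : SRPropagation Ω) (hnz : ∀ α ∈ Ω, That α ≠ 0)
    (T : Idx n → ℝ) (hT : IsRankOne T) (hTm : ∀ α ∈ Ω, T α = That α) :
    SDPETight Ω That T := by
  refine ⟨⟨?_, fun α hα => hTm α hα, fun α hα => ?_, fun _ _ _ _ h => ?_,
    border_vecMulVec_self_posSemidef T⟩, fun x X h => ?_⟩
  · ext a b
    simp [Matrix.vecMulVec_apply, mul_comm]
  · rw [Matrix.vecMulVec_apply, hTm α hα, sq]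
  · simpa only [Matrix.vecMulVec_apply] using hT.mul_eq_mul_of_isSquare h
  · obtain rfl := h.eq_of_SRPropagation hSR hnz hT hTm
    have hdiag : ∀ α ∈ Finset.univ, Matrix.vecMulVec x x α α ≤ X α α := fun α _ => by
      rw [Matrix.vecMulVec_apply, ← sq]
      exact sq_le_diag_of_border_posSemidef h.psd α
    refine ⟨Finset.sum_le_sum hdiag, fun htr => ⟨rfl, ?_⟩⟩
    have heq := (Finset.sum_eq_sum_iff_of_le hdiag).1 htr.symm
    ext β α
    rw [Matrix.vecMulVec_apply]
    refine apply_eq_mul_of_diag_eq_sq h.psd ?_ β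
    rw [← heq α (Finset.mem_univ α), Matrix.vecMulVec_apply, sq]

end RankOneTC
end

section
/- Assume Ω satisfies GS-propagation, the observed values T̂_α are nonzero for all α ∈ Ω, and there exists a rank-one tensor T with T_α = T̂_α for all α ∈ Ω. Then there exists a nonnegative weight vector w ∈ ℝ^N such that the weighted relaxation (SDP-Eʷ) is tight, i.e. its unique optimal solution is the matrix 𝐗̄ built from the unique rank-one completion. -/
namespace RankOneTC

open scoped BigOperators
open MeasureTheory

/-- The unordered pairs `{a, b}` and `{c, e}` coincide in every coordinate. -/
def SamePairs {d : ℕ} {n : Fin d → ℕ} (a b c e : Idx n) : Prop :=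
  ∀ k, (a k = c k ∧ b k = e k) ∨ (a k = e k ∧ b k = c k)

lemma IsSquare.samePairs {d : ℕ} {n : Fin d → ℕ} {a b c e : Idx n} (h : IsSquare a b c e) :
    SamePairs a b c e := by
  intro k
  obtain ⟨h₁, h₂⟩ := h.2 k
  grind

lemma SamePairs.eq_of_isSymm {d : ℕ} {n : Fin d → ℕ} {a b c e : Idx n}
    {X : Matrix (Idx n) (Idx n) ℝ} (h : SamePairs a b c e) (hX : X.IsSymm)
    (hsq : ∀ a b c e : Idx n, IsSquare a b c e → X a b = X c e) : X a b = X c e := by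
  by_cases hac : a = c
  · have hbe : b = e := funext fun k => by have := h k; grind
    rw [hac, hbe]
  by_cases hae : a = e
  · have hbc : b = c := funext fun k => by have := h k; grind
    rw [hae, hbc, hX.apply]
  have hbc : b ≠ c := fun hbc => hae (funext fun k => by have := h k; grind)
  have hbe : b ≠ e := fun hbe => hac (funext fun k => by have := h k; grind)
  have hab : a ≠ b := fun hab => hac (funext fun k => by have := h k; grind)
  have hce : c ≠ e := fun hce => hac (funext fun k => by have := h k; grind)
  refine hsq a b c e ⟨by simp [*], fun k => ?_⟩
  rcases h k with ⟨h₁, h₂⟩ | ⟨h₁, h₂⟩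
  · rw [h₁, h₂]; exact ⟨rfl, rfl⟩
  · rw [h₁, h₂]; exact ⟨max_comm _ _, min_comm _ _⟩

lemma SamePairs.mul_eq_of_isRankOne {d : ℕ} {n : Fin d → ℕ} {a b c e : Idx n}
    {T : Idx n → ℝ} (h : SamePairs a b c e) (hT : IsRankOne T) : T a * T b = T c * T e := by
  obtain ⟨u, hu⟩ := hT
  simp only [hu, ← Finset.prod_mul_distrib]
  refine Finset.prod_congr rfl fun k _ => ?_
  rcases h k with ⟨h₁, h₂⟩ | ⟨h₁, h₂⟩
  · rw [h₁, h₂]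
  · rw [h₁, h₂, mul_comm]

lemma IsGenSquare.apply_eq {d : ℕ} {n : Fin d → ℕ} {a b c e : Idx n}
    (h : IsGenSquare a b c e) (k : Fin d) :
    (a k = b k ∧ c k = e k) ∨ (a k = c k ∧ b k = e k) ∨ (a k = e k ∧ b k = c k) := by
  have key (s : Fin (n k)) : (if a k = s then (1 : ZMod 2) else 0) + (if b k = s then 1 else 0)
      + (if c k = s then 1 else 0) + (if e k = s then 1 else 0) = 0 := by
    simpa [vF2] using congrFun h.2 ⟨k, s⟩
  have ha := key (a k)
  have hb := key (b k)
  have hc := key (c k)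
  by_cases hab : a k = b k <;> by_cases hac : a k = c k <;> by_cases hae : a k = e k <;>
    by_cases hbc : b k = c k <;> by_cases hbe : b k = e k <;> by_cases hce : c k = e k <;>
    grind

/-- A generalized square is linked by three auxiliary tuples through ordinary squares. -/
lemma IsGenSquare.exists_samePairs {d : ℕ} {n : Fin d → ℕ} {a b c e : Idx n}
    (h : IsGenSquare a b c e) :
    ∃ p q r : Idx n, SamePairs p q a b ∧ SamePairs p r a c ∧ SamePairs q r a e := by
  have key (k : Fin d) : ∃ p q r : Fin (n k),
      ((p = a k ∧ q = b k) ∨ (p = b k ∧ q = a k)) ∧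
      ((p = a k ∧ r = c k) ∨ (p = c k ∧ r = a k)) ∧
      ((q = a k ∧ r = e k) ∨ (q = e k ∧ r = a k)) := by
    rcases h.apply_eq k with ⟨h₁, h₂⟩ | ⟨h₁, h₂⟩ | ⟨h₁, h₂⟩
    · exact ⟨a k, a k, c k, by simp [h₁, h₂]⟩
    · exact ⟨a k, b k, a k, by simp [h₁, h₂]⟩
    · exact ⟨b k, a k, a k, by simp [h₁, h₂]⟩
  choose p q r hpq hpr hqr using key
  exact ⟨p, q, r, hpq, hpr, hqr⟩

/-- A rank-one tensor that is nonzero on `Ω` is nonzero on the GS-propagated set. -/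
lemma PGS.ne_zero {d : ℕ} {n : Fin d → ℕ} {Ω : Set (Idx n)} {T : Idx n → ℝ}
    (hT : IsRankOne T) (hΩ : ∀ α ∈ Ω, T α ≠ 0) {β : Idx n} (hβ : PGS Ω β) : T β ≠ 0 := by
  obtain ⟨u, hu⟩ := hT
  have key (k : Fin d) : u k (β k) ≠ 0 := by
    induction hβ with
    | base hα =>
      have := hΩ _ hα
      rw [hu, Finset.prod_ne_zero_iff] at this
      exact this k (Finset.mem_univ k)
    | prop hsq _ _ _ h₁ h₂ h₃ =>
      rcases hsq.apply_eq k with ⟨_, h⟩ | ⟨_, h⟩ | ⟨h, _⟩ <;> rw [← h] <;> assumption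
  rw [hu]
  exact Finset.prod_ne_zero_iff.2 fun k _ => key k

/-- The squared distance between the Gram vectors of indices `a` and `b`. -/
def gramDist {ι : Type*} (M : Matrix ι ι ℝ) (a b : ι) : ℝ := M a a + M b b - 2 * M a b

lemma _root_.Matrix.PosSemidef.symm_apply {ι : Type*} {M : Matrix ι ι ℝ} (hM : M.PosSemidef)
    (a b : ι) : M a b = M b a := by
  simpa using hM.isHermitian.apply b a

section Gram

open Matrix

variable {ι : Type*} [Fintype ι] [DecidableEq ι] {M : Matrix ι ι ℝ}

lemma _root_.Matrix.PosSemidef.gram_midpoint_nonneg (hM : M.PosSemidef) (a b c : ι) :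
    0 ≤ M a a + M b b + 4 * M c c + 2 * M a b - 4 * M a c - 4 * M b c := by
  have h := hM.dotProduct_mulVec_nonneg (Pi.single a 1 + Pi.single b 1 - Pi.single c (2 : ℝ))
  simp [mulVec_add, mulVec_sub, dotProduct_add, add_dotProduct, sub_dotProduct,
    dotProduct_sub] at h
  have h₁ := hM.symm_apply a b
  have h₂ := hM.symm_apply a c
  have h₃ := hM.symm_apply b c
  linarith

lemma _root_.Matrix.PosSemidef.gramDist_nonneg (hM : M.PosSemidef) (a b : ι) :
    0 ≤ gramDist M a b := by
  have := hM.gram_midpoint_nonneg a a b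
  unfold gramDist
  linarith

lemma _root_.Matrix.PosSemidef.apply_eq_of_gramDist_eq_zero (hM : M.PosSemidef) {a b : ι}
    (h : gramDist M a b = 0) (c : ι) : M c a = M c b := by
  have h₀ : M *ᵥ (Pi.single a 1 - Pi.single b (1 : ℝ)) = 0 := by
    rw [← hM.dotProduct_mulVec_zero_iff]
    have := hM.symm_apply a b
    simp [mulVec_sub, sub_dotProduct, dotProduct_sub]
    unfold gramDist at h
    linarith
  have := congrFun h₀ c
  simp [mulVec_sub] at this
  linarith

end Gram

/-- Feasibility of a bordered matrix for the problem whose completion is the all-ones tensor. -/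
structure OnesFeasible {d : ℕ} {n : Fin d → ℕ} (Ω : Set (Idx n))
    (M : Matrix (Option (Idx n)) (Option (Idx n)) ℝ) : Prop where
  psd : M.PosSemidef
  corner : M none none = 1
  obs : ∀ α ∈ Ω, M (some α) none = 1
  obsDiag : ∀ α ∈ Ω, M (some α) (some α) = 1
  pairs : ∀ a b c e : Idx n, SamePairs a b c e → M (some a) (some b) = M (some c) (some e)

/-- The generalized-square step of the certificate, as an estimate on Gram vectors. -/
lemma OnesFeasible.gramDist_le {d : ℕ} {n : Fin d → ℕ} {Ω : Set (Idx n)}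
    {M : Matrix (Option (Idx n)) (Option (Idx n)) ℝ} (hM : OnesFeasible Ω M)
    {a b c e p q r : Idx n} (hpq : SamePairs p q a b) (hpr : SamePairs p r a c)
    (hqr : SamePairs q r a e) :
    gramDist M (some e) none ≤
      2 * (M (some e) (some e) - 3 * M (some a) (some a) + M (some q) (some q)
        + M (some r) (some r) + 4 * M (some p) (some p) - 2 * M (some b) (some b)
        - 2 * M (some c) (some c)) +
      18 * gramDist M (some a) none + 8 * gramDist M (some b) none
        + 8 * gramDist M (some c) none := by
  have h₁ := hM.psd.gram_midpoint_nonneg (some e) none (some a)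
  have h₂ := hM.psd.gram_midpoint_nonneg (some q) (some r) (some p)
  have h₃ := hM.psd.gram_midpoint_nonneg (some a) (some b) none
  have h₄ := hM.psd.gram_midpoint_nonneg (some a) (some c) none
  have e₁ := hM.pairs _ _ _ _ hpq
  have e₂ := hM.pairs _ _ _ _ hpr
  have e₃ := hM.pairs _ _ _ _ hqr
  have s₁ := hM.psd.symm_apply (some p) (some q)
  have s₂ := hM.psd.symm_apply (some p) (some r)
  have s₃ := hM.psd.symm_apply (some a) (some e)
  have s₄ := hM.psd.symm_apply (some a) none
  unfold gramDist
  linarith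

/-- Every propagated tuple has a nonnegative weight vector certifying that its Gram vector
agrees with that of the border. -/
lemma PGS.exists_weight {d : ℕ} {n : Fin d → ℕ} {Ω : Set (Idx n)} {β : Idx n}
    (hβ : PGS Ω β) :
    ∃ w : Idx n → ℝ, (∀ γ, 0 ≤ w γ) ∧ 1 ≤ w β ∧ ∀ M, OnesFeasible Ω M →
      gramDist M (some β) none ≤ ∑ γ, w γ * (M (some γ) (some γ) - 1) := by
  induction hβ with
  | @base α hα =>
    refine ⟨Pi.single α 1, fun γ => ?_, by simp, fun M hM => ?_⟩
    · exact (Pi.single_nonneg.2 zero_le_one : (0 : Idx n → ℝ) ≤ Pi.single α 1) γ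
    · have : ∑ γ, (Pi.single α (1 : ℝ) : Idx n → ℝ) γ * (M (some γ) (some γ) - 1) =
          M (some α) (some α) - 1 := by simp [Pi.single_apply]
      rw [this, gramDist, hM.corner, hM.obs α hα, hM.obsDiag α hα]
      norm_num
  | @prop a b c e hsq _ _ _ ha hb hc =>
    obtain ⟨u, hu, hua, hMa⟩ := ha
    obtain ⟨v, hv, hvb, hMb⟩ := hb
    obtain ⟨w, hw, hwc, hMc⟩ := hc
    obtain ⟨p, q, r, hpq, hpr, hqr⟩ := hsq.exists_samePairs
    let δ (x γ : Idx n) : ℝ := if γ = x then 1 else 0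
    have hδ (x γ : Idx n) : 0 ≤ δ x γ := by dsimp only [δ]; split_ifs <;> norm_num
    have hle (x : Idx n) (f : Idx n → ℝ) (hf : ∀ γ, 0 ≤ f γ) (hx : 1 ≤ f x) (γ : Idx n) :
        δ x γ ≤ f γ := by
      dsimp only [δ]
      split_ifs with h
      · rwa [h]
      · exact hf γ
    have hbound (γ : Idx n) : 2 * δ e γ ≤
        2 * (δ e γ - 3 * δ a γ + δ q γ + δ r γ + 4 * δ p γ - 2 * δ b γ - 2 * δ c γ)
          + 18 * u γ + 8 * v γ + 8 * w γ := by
      have := hle a u hu hua γ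
      have := hle b v hv hvb γ
      have := hle c w hw hwc γ
      have := hu γ
      have := hv γ
      have := hw γ
      have := hδ q γ
      have := hδ r γ
      have := hδ p γ
      linarith
    refine ⟨fun γ =>
      2 * (δ e γ - 3 * δ a γ + δ q γ + δ r γ + 4 * δ p γ - 2 * δ b γ - 2 * δ c γ)
        + 18 * u γ + 8 * v γ + 8 * w γ, fun γ => ?_, ?_, fun M hM => ?_⟩
    · have := hbound γ
      have := hδ e γ
      linarith
    · have := hbound e
      have h₁ : δ e e = 1 := if_pos rfl
      rw [h₁] at this
      linarith
    · have hsum (x : Idx n) : ∑ γ, δ x γ * (M (some γ) (some γ) - 1) =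
          M (some x) (some x) - 1 := by simp [δ]
      have h₁ := hMa M hM
      have h₂ := hMb M hM
      have h₃ := hMc M hM
      have h₄ := hM.gramDist_le hpq hpr hqr
      simp only [add_mul, sub_mul, mul_assoc, Finset.sum_add_distrib, Finset.sum_sub_distrib,
        ← Finset.mul_sum, hsum]
      linarith

/-- The matrix `border x X` rescaled by the entries of `T`. -/
noncomputable def rescaledBorder {d : ℕ} {n : Fin d → ℕ} (T x : Idx n → ℝ)
    (X : Matrix (Idx n) (Idx n) ℝ) : Matrix (Option (Idx n)) (Option (Idx n)) ℝ :=
  Matrix.diagonal (fun o => (o.elim 1 T)⁻¹) * border x X *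
    Matrix.diagonal (fun o => (o.elim 1 T)⁻¹)

lemma rescaledBorder_apply {d : ℕ} {n : Fin d → ℕ} (T x : Idx n → ℝ)
    (X : Matrix (Idx n) (Idx n) ℝ) (a b : Option (Idx n)) :
    rescaledBorder T x X a b = (a.elim 1 T)⁻¹ * border x X a b * (b.elim 1 T)⁻¹ := by
  simp [rescaledBorder, Matrix.mul_diagonal, Matrix.diagonal_mul]

lemma SDPEFeasible.onesFeasible {d : ℕ} {n : Fin d → ℕ} {Ω : Set (Idx n)}
    {That T x : Idx n → ℝ} {X : Matrix (Idx n) (Idx n) ℝ} (h : SDPEFeasible Ω That x X)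
    (hT : IsRankOne T) (hT₀ : ∀ α, T α ≠ 0) (hTm : ∀ α ∈ Ω, T α = That α) :
    OnesFeasible Ω (rescaledBorder T x X) where
  psd := by
    have := h.psd.mul_mul_conjTranspose_same
      (Matrix.diagonal fun o : Option (Idx n) => (o.elim 1 T)⁻¹)
    rwa [Matrix.diagonal_conjTranspose, star_trivial] at this
  corner := by simp [rescaledBorder_apply, border]
  obs α hα := by
    have := hT₀ α
    simp [rescaledBorder_apply, border, h.obs α hα, ← hTm α hα, this]
  obsDiag α hα := by
    have := hT₀ α
    simp only [rescaledBorder_apply, border, Matrix.of_apply, Option.elim, h.obsDiag α hα,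
      ← hTm α hα]
    field_simp
  pairs a b c e hp := by
    have h₁ := hp.eq_of_isSymm h.isSymm h.squares
    have h₂ := hp.mul_eq_of_isRankOne hT
    have h₃ (a b : Idx n) : rescaledBorder T x X (some a) (some b) = X a b * (T a * T b)⁻¹ := by
      simp only [rescaledBorder_apply, border, Matrix.of_apply, Option.elim, mul_inv]
      ring
    rw [h₃, h₃, h₁, h₂]

lemma sdpeFeasible_vecMulVec {d : ℕ} {n : Fin d → ℕ} {Ω : Set (Idx n)} {That T : Idx n → ℝ}
    (hT : IsRankOne T) (hTm : ∀ α ∈ Ω, T α = That α) :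
    SDPEFeasible Ω That T (Matrix.vecMulVec T T) where
  isSymm := by ext a b; simp [Matrix.vecMulVec_apply, mul_comm]
  obs := hTm
  obsDiag α hα := by rw [Matrix.vecMulVec_apply, hTm α hα, sq]
  squares a b c e h := h.samePairs.mul_eq_of_isRankOne hT
  psd := by
    have : border T (Matrix.vecMulVec T T) =
        Matrix.vecMulVec (fun o => o.elim 1 T) (star fun o => o.elim 1 T) := by
      ext (_ | a) (_ | b) <;> simp [border, Matrix.vecMulVec_apply]
    rw [this]
    exact Matrix.posSemidef_vecMulVec_self_star _

/-- Under GS-propagation and nonzero observations, there is a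
nonnegative weight vector `w` for which the weighted relaxation (SDP-Eʷ) is tight. -/
theorem statement10 {d : ℕ} {n : Fin d → ℕ} (Ω : Set (Idx n)) (That : Idx n → ℝ)
    (hGS : GSPropagation Ω) (hnz : ∀ α ∈ Ω, That α ≠ 0)
    (T : Idx n → ℝ) (hT : IsRankOne T) (hTm : ∀ α ∈ Ω, T α = That α) :
    ∃ w : Idx n → ℝ, (∀ β, 0 ≤ w β) ∧ SDPEwTight Ω w That T := by
  have hT₀ (β : Idx n) : T β ≠ 0 := (hGS β).ne_zero hT fun α hα => hTm α hα ▸ hnz α hα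
  choose w hw _ hM using fun β => (hGS β).exists_weight
  have hscale (f : Idx n → ℝ) : ∑ γ, (∑ β, w β γ) * (T γ ^ 2)⁻¹ * f γ -
      ∑ γ, (∑ β, w β γ) * (T γ ^ 2)⁻¹ * Matrix.vecMulVec T T γ γ =
      ∑ β, ∑ γ, w β γ * (f γ * (T γ ^ 2)⁻¹ - 1) := by
    rw [Finset.sum_comm, ← Finset.sum_sub_distrib]
    refine Finset.sum_congr rfl fun γ _ => ?_
    have := hT₀ γ
    rw [← Finset.sum_mul, Matrix.vecMulVec_apply]
    field_simp
  refine ⟨fun γ => (∑ β, w β γ) * (T γ ^ 2)⁻¹, fun γ => ?_, sdpeFeasible_vecMulVec hT hTm,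
    fun x X hX => ?_⟩
  · exact mul_nonneg (Finset.sum_nonneg fun β _ => hw β γ) (by positivity)
  have hR := hX.onesFeasible hT hT₀ hTm
  have hdiag (γ : Idx n) :
      rescaledBorder T x X (some γ) (some γ) = X γ γ * (T γ ^ 2)⁻¹ := by
    simp only [rescaledBorder_apply, border, Matrix.of_apply, Option.elim, sq, mul_inv]
    ring
  have hdist (β : Idx n) : gramDist (rescaledBorder T x X) (some β) none ≤
      ∑ γ, w β γ * (X γ γ * (T γ ^ 2)⁻¹ - 1) := by
    simpa only [hdiag] using hM β _ hR
  have hnonneg (β : Idx n) := hR.psd.gramDist_nonneg (some β) none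
  have hsum := Finset.sum_le_sum fun β (_ : β ∈ Finset.univ) => hdist β
  rw [← hscale fun γ => X γ γ] at hsum
  have hpos := Finset.sum_nonneg fun β (_ : β ∈ Finset.univ) => hnonneg β
  refine ⟨by linarith, fun heq => ?_⟩
  have hzero (β : Idx n) : gramDist (rescaledBorder T x X) (some β) none = 0 :=
    (Finset.sum_eq_zero_iff_of_nonneg fun β _ => hnonneg β).1 (by linarith) β
      (Finset.mem_univ β)
  have hcol (β : Idx n) := hR.psd.apply_eq_of_gramDist_eq_zero (hzero β)
  have hx (β : Idx n) : rescaledBorder T x X (some β) none = 1 := by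
    rw [hR.psd.symm_apply, hcol, hR.corner]
  constructor
  · ext β
    have := hx β
    have := hT₀ β
    simp_all [rescaledBorder_apply, border, inv_mul_eq_one₀]
  · ext α β
    have h₁ := hx α
    rw [← hcol β] at h₁
    have := hT₀ α
    have := hT₀ β
    simp only [rescaledBorder_apply, border, Matrix.of_apply, Option.elim] at h₁
    rw [Matrix.vecMulVec_apply]
    field_simp at h₁
    linarith

end RankOneTC
end
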